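/- Let X be a Banach space and let {T(t)}_{t≥0} be a C0-semigroup on X satisfying ‖T(t)‖ ≤ M e^{ωt} for all t ≥ 0, with constants M > 0 and ω ≥ 0. Then the infinitesimal generator A (with domain the set of x for which the limit (T(t)x − x)/t as t → 0+ exists) is a densely defined closed operator, λI − A is invertible for all λ > ω, and ‖(λI − A)^{-n}‖ ≤ M (λ − ω)^{-n} for all λ > ω and n ∈ ℕ. -/

import Mathlib

open Filter Topology

open MeasureTheory in
theorem hy_core
    {X : Type*} [NormedAddCommGroup X] [NormedSpace ℝ X] [CompleteSpace X]
    (T : ℝ → X →L[ℝ] X) (M ω : ℝ) (hM : 0 < M)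
    (hT0 : T 0 = 1)
    (hTadd : ∀ s t : ℝ, 0 ≤ s → 0 ≤ t → T (s + t) = (T s).comp (T t))
    (hTcont : ∀ x : X, ContinuousOn (fun t => T t x) (Set.Ici (0 : ℝ)))
    (hTbound : ∀ t : ℝ, 0 ≤ t → ‖T t‖ ≤ M * Real.exp (ω * t))
    (lam : ℝ) (hlam : ω < lam) :
    ∃ R : X →L[ℝ] X,
      (∀ h y, 0 ≤ h → T h (R y) = R (T h y)) ∧
      (∀ y, ∃ I : ℝ → X, HasDerivWithinAt I y (Set.Ioi 0) 0 ∧ I 0 = 0 ∧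
        ∀ h, 0 ≤ h → I h = R y - Real.exp (-lam * h) • T h (R y)) ∧
      (∀ n : ℕ, ‖R ^ n‖ ≤ M * ((lam - ω)⁻¹) ^ n) := by
  have hneg : ω - lam < 0 := by linarith
  set f : X → ℝ → X := fun y t => Real.exp (-lam * t) • T t y with hf
  have hfc : ∀ y, ContinuousOn (f y) (Set.Ici 0) := fun y =>
    (Continuous.continuousOn (by fun_prop)).smul (hTcont y)
  -- general domination
  have hdom : ∀ (x : X) (C : ℝ), (∀ t, 0 ≤ t → ‖T t x‖ ≤ C * Real.exp (ω * t)) →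
      ∀ t ∈ Set.Ioi (0 : ℝ), ‖f x t‖ ≤ C * Real.exp ((ω - lam) * t) := by
    intro x C hC t ht
    have h1 := hC t (le_of_lt ht)
    calc ‖f x t‖ = Real.exp (-lam * t) * ‖T t x‖ := by
          simp [hf, norm_smul]
      _ ≤ Real.exp (-lam * t) * (C * Real.exp (ω * t)) := by gcongr
      _ = C * Real.exp ((ω - lam) * t) := by
          rw [show (ω - lam) * t = -lam * t + ω * t by ring, Real.exp_add]; ring
  have hexpint : ∀ C : ℝ, IntegrableOn (fun t : ℝ => C * Real.exp ((ω - lam) * t))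
      (Set.Ioi 0) := fun C => (integrableOn_exp_mul_Ioi hneg 0).const_mul C
  have hTx : ∀ (x : X) (t : ℝ), 0 ≤ t → ‖T t x‖ ≤ (M * ‖x‖) * Real.exp (ω * t) := by
    intro x t ht
    calc ‖T t x‖ ≤ ‖T t‖ * ‖x‖ := (T t).le_opNorm x
      _ ≤ (M * Real.exp (ω * t)) * ‖x‖ := by gcongr; exact hTbound t ht
      _ = _ := by ring
  have hfi : ∀ y, IntegrableOn (f y) (Set.Ioi 0) := by
    intro y
    refine Integrable.mono' (hexpint (M * ‖y‖))
      (((hfc y).mono Set.Ioi_subset_Ici_self).aestronglyMeasurable measurableSet_Ioi) ?_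
    exact (ae_restrict_iff' measurableSet_Ioi).2 (Eventually.of_forall (hdom y _ (hTx y)))
  have hbd : ∀ (x : X) (C : ℝ), (∀ t, 0 ≤ t → ‖T t x‖ ≤ C * Real.exp (ω * t)) →
      ‖∫ t in Set.Ioi 0, f x t‖ ≤ C * (lam - ω)⁻¹ := by
    intro x C hC
    have h1 := norm_integral_le_of_norm_le (hexpint C)
      ((ae_restrict_iff' measurableSet_Ioi).2 (Eventually.of_forall (hdom x C hC)))
    refine h1.trans (le_of_eq ?_)
    rw [integral_const_mul, integral_exp_mul_Ioi hneg]
    congr 1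
    rw [mul_zero, Real.exp_zero, neg_div, ← div_neg, neg_sub, one_div]
  let R : X →L[ℝ] X := LinearMap.mkContinuous
    { toFun := fun y => ∫ t in Set.Ioi 0, f y t
      map_add' := by
        intro x y
        rw [← integral_add (hfi x) (hfi y)]
        simp [hf]
      map_smul' := by
        intro c x
        rw [RingHom.id_apply, ← integral_smul]
        simp only [hf, map_smul]
        congr 1; ext t; rw [smul_comm] }
    (M * (lam - ω)⁻¹) (by
      intro x
      refine (hbd x _ (hTx x)).trans (le_of_eq (by ring)))
  have hR : ∀ y, R y = ∫ t in Set.Ioi 0, f y t := fun y => rfl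
  have hcomm' : ∀ h t y, 0 ≤ h → 0 ≤ t → T h (T t y) = T t (T h y) := by
    intro h t y hh ht
    rw [← ContinuousLinearMap.comp_apply, ← ContinuousLinearMap.comp_apply,
      ← hTadd h t hh ht, ← hTadd t h ht hh, add_comm]
  have hTR : ∀ h y, T h (R y) = ∫ t in Set.Ioi 0, T h (f y t) := by
    intro h y
    rw [hR, ← ContinuousLinearMap.integral_comp_comm _ (hfi y)]
  have hcomm : ∀ h y, 0 ≤ h → T h (R y) = R (T h y) := by
    intro h y hh
    rw [hTR, hR]
    refine setIntegral_congr_fun measurableSet_Ioi fun t ht => ?_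
    simp only [hf, map_smul, hcomm' h t y hh (le_of_lt ht)]
  refine ⟨R, hcomm, ?_, ?_⟩
  · intro y
    refine ⟨fun h => ∫ t in (0 : ℝ)..h, f y t, ?_, by simp, ?_⟩
    · have h0 : f y 0 = y := by simp [hf, hT0]
      have hc : ContinuousWithinAt (f y) (Set.Ioi 0) 0 :=
        ((hfc y) 0 Set.self_mem_Ici).mono Set.Ioi_subset_Ici_self
      have := intervalIntegral.integral_hasDerivWithinAt_right (f := f y) (a := 0) (b := 0)
        (s := Set.Ici 0) (t := Set.Ioi 0) (by simp)
        ⟨Set.Ioi 0, self_mem_nhdsWithin,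
          ((hfc y).mono Set.Ioi_subset_Ici_self).aestronglyMeasurable measurableSet_Ioi⟩ hc
      rw [h0] at this
      exact this.mono Set.Ioi_subset_Ici_self
    · intro h hh
      have h1 : Real.exp (-lam * h) • T h (R y) = ∫ t in Set.Ioi h, f y t := by
        have hpre := (measurePreserving_add_right (volume : Measure ℝ) h).setIntegral_preimage_emb
          (measurableEmbedding_addRight h) (f y) (Set.Ioi h)
        rw [← hpre, hTR, ← integral_smul]
        have : (fun x : ℝ => x + h) ⁻¹' Set.Ioi h = Set.Ioi 0 := by
          ext x; simp
        rw [this]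
        refine setIntegral_congr_fun measurableSet_Ioi fun t ht => ?_
        have ht' : (0 : ℝ) ≤ t := le_of_lt ht
        simp only [hf, map_smul]
        rw [add_comm t h, hTadd h t hh ht', smul_smul, ← Real.exp_add, mul_add]
        rfl
      rw [h1, hR, intervalIntegral.integral_Ioi_sub_Ioi (hfi y) hh]
  · have key : ∀ (n : ℕ) (y : X) (s : ℝ), 0 ≤ s →
        ‖T s ((R ^ n) y)‖ ≤ (M * ((lam - ω)⁻¹) ^ n * ‖y‖) * Real.exp (ω * s) := by
      intro n
      induction n with
      | zero => intro y s hs; simpa using hTx y s hs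
      | succ n ih =>
        intro y s hs
        have e : T s ((R ^ (n + 1)) y) = R (T s ((R ^ n) y)) := by
          rw [pow_succ', ContinuousLinearMap.mul_apply, hcomm s _ hs]
        rw [e, hR]
        refine (hbd _ (M * ((lam - ω)⁻¹) ^ n * ‖y‖ * Real.exp (ω * s)) ?_).trans
          (le_of_eq (by ring))
        intro t ht
        have := ih y (t + s) (by positivity)
        rw [hTadd t s ht hs, mul_add, Real.exp_add] at this
        refine this.trans (le_of_eq (by ring))
    intro n
    have hpos : 0 < lam - ω := by linarith
    refine ContinuousLinearMap.opNorm_le_bound _ (by positivity) fun y => ?_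
    simpa [hT0] using key n y 0 le_rfl

/-- Hille–Yosida-type theorem: for a C0-semigroup `T` on a Banach space `X` with
`‖T t‖ ≤ M exp (ω t)`, the infinitesimal generator (described here through its graph)
is densely defined and closed, `λI - A` is invertible for `λ > ω`, and
`‖(λI - A)⁻ⁿ‖ ≤ M (λ - ω)⁻ⁿ`. -/
theorem stmt0
    {X : Type*} [NormedAddCommGroup X] [NormedSpace ℝ X] [CompleteSpace X]
    (T : ℝ → X →L[ℝ] X) (M ω : ℝ) (hM : 0 < M) (hω : 0 ≤ ω)
    (hT0 : T 0 = 1)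
    (hTadd : ∀ s t : ℝ, 0 ≤ s → 0 ≤ t → T (s + t) = (T s).comp (T t))
    (hTcont : ∀ x : X, ContinuousOn (fun t => T t x) (Set.Ici (0 : ℝ)))
    (hTbound : ∀ t : ℝ, 0 ≤ t → ‖T t‖ ≤ M * Real.exp (ω * t)) :
    -- the generator is densely defined
    Dense {x : X | ∃ y : X,
        Tendsto (fun t : ℝ => t⁻¹ • (T t x - x)) (𝓝[>] 0) (𝓝 y)} ∧
    -- the generator is a closed operator (its graph is closed)
    IsClosed {p : X × X |
        Tendsto (fun t : ℝ => t⁻¹ • (T t p.1 - p.1)) (𝓝[>] 0) (𝓝 p.2)} ∧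
    -- for every λ > ω, λI - A is invertible with the resolvent bounds
    ∀ lam : ℝ, ω < lam → ∃ R : X →L[ℝ] X,
      (∀ y : X, Tendsto (fun t : ℝ => t⁻¹ • (T t (R y) - R y)) (𝓝[>] 0)
          (𝓝 (lam • R y - y))) ∧
      (∀ x y : X, Tendsto (fun t : ℝ => t⁻¹ • (T t x - x)) (𝓝[>] 0) (𝓝 y) →
          R (lam • x - y) = x) ∧
      (∀ n : ℕ, 1 ≤ n → ‖R ^ n‖ ≤ M * ((lam - ω)⁻¹) ^ n) := by
  have core := hy_core T M ω hM hT0 hTadd hTcont hTbound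
  have full : ∀ lam : ℝ, ω < lam → ∃ R : X →L[ℝ] X,
      ((∀ h y, 0 ≤ h → T h (R y) = R (T h y)) ∧
      (∀ y, ∃ I : ℝ → X, HasDerivWithinAt I y (Set.Ioi 0) 0 ∧ I 0 = 0 ∧
        ∀ h, 0 ≤ h → I h = R y - Real.exp (-lam * h) • T h (R y))) ∧
      (∀ y : X, Tendsto (fun t : ℝ => t⁻¹ • (T t (R y) - R y)) (𝓝[>] 0)
          (𝓝 (lam • R y - y))) ∧
      (∀ x y : X, Tendsto (fun t : ℝ => t⁻¹ • (T t x - x)) (𝓝[>] 0) (𝓝 y) →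
          R (lam • x - y) = x) ∧
      (∀ n : ℕ, 1 ≤ n → ‖R ^ n‖ ≤ M * ((lam - ω)⁻¹) ^ n) := by
    intro lam hlam
    obtain ⟨R, hcomm, hI, hpow⟩ := core lam hlam
    have h1 : ∀ y : X, Tendsto (fun t : ℝ => t⁻¹ • (T t (R y) - R y)) (𝓝[>] 0)
          (𝓝 (lam • R y - y)) := by
      intro y
      obtain ⟨I, hd, h0, hI⟩ := hI y
      have he : HasDerivWithinAt (fun t : ℝ => Real.exp (lam * t)) lam (Set.Ioi 0) 0 := by
        have := ((hasDerivAt_id (0 : ℝ)).const_mul lam).exp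
        simpa using this.hasDerivWithinAt
      have hg := he.smul (hd.const_sub (R y))
      rw [hasDerivWithinAt_iff_tendsto_slope' (by simp)] at hg
      have hval : Real.exp (lam * 0) • -y + lam • (R y - I 0) = lam • R y - y := by
        rw [h0]; simp; abel
      rw [hval] at hg
      refine hg.congr' ?_
      filter_upwards [self_mem_nhdsWithin] with t ht
      have ht' : (0 : ℝ) ≤ t := le_of_lt ht
      have e1 : R y - I t = Real.exp (-lam * t) • T t (R y) := by rw [hI t ht']; abel
      simp only [slope, vsub_eq_sub, sub_zero, Pi.smul_apply', e1, h0, smul_smul, ← Real.exp_add]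
      simp
    refine ⟨R, ⟨hcomm, hI⟩, h1, ?_, fun n _ => hpow n⟩
    intro x y hxy
    have h2 := (R.continuous.tendsto y).comp hxy
    have h3 : Tendsto (fun t : ℝ => t⁻¹ • (T t (R x) - R x)) (𝓝[>] 0) (𝓝 (R y)) := by
      refine h2.congr' ?_
      filter_upwards [self_mem_nhdsWithin] with t ht
      have ht' : (0 : ℝ) ≤ t := le_of_lt ht
      simp [hcomm t x ht']
    have h4 := tendsto_nhds_unique h3 (h1 x)
    rw [map_sub, map_smul, h4]; abel
  refine ⟨?_, ?_, fun lam hlam => (full lam hlam).imp fun R h => h.2⟩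
  · obtain ⟨R, ⟨hcomm, hI⟩, hran, -, -⟩ := full (ω + 1) (by linarith)
    intro y
    obtain ⟨I, hd, h0, hI⟩ := hI y
    rw [hasDerivWithinAt_iff_tendsto_slope' (by simp)] at hd
    refine mem_closure_of_tendsto hd ?_
    filter_upwards [self_mem_nhdsWithin] with t ht
    have ht' : (0 : ℝ) ≤ t := le_of_lt ht
    have e1 : slope I 0 t = R (t⁻¹ • (y - Real.exp (-(ω + 1) * t) • T t y)) := by
      simp [slope, h0, hI t ht', hcomm t y ht']
    rw [e1]
    exact ⟨_, hran _⟩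
  · obtain ⟨R, -, h1, h2, -⟩ := full (ω + 1) (by linarith)
    have : {p : X × X | Tendsto (fun t : ℝ => t⁻¹ • (T t p.1 - p.1)) (𝓝[>] 0) (𝓝 p.2)}
        = {p : X × X | R ((ω + 1) • p.1 - p.2) = p.1} := by
      ext ⟨x, y⟩
      refine ⟨fun h => h2 x y h, fun h => ?_⟩
      have h3 := h1 ((ω + 1) • x - y)
      simp only [Set.mem_setOf_eq] at h
      rw [h] at h3
      simpa using h3
    rw [this]
    exact isClosed_eq (by fun_prop) (by fun_prop)
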